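/- arXiv:1006.2871 — 11 statements merged into one kernel-verified Lean document; each statement's English description precedes it below -/
import Mathlib

section
/- Fix data y ∈ ℝⁿ and predictors x_{i,kj} (i = 1,…,n; groups k = 1,…,K with p_k variables each). Let λ₁ > 0, λ₂ > 0 and set λ = λ₁λ₂. If (d*, α*) with d*_k ≥ 0 for all k is a local maximizer of the two-parameter hierarchical lasso criterion Q*(λ₁, λ₂, d, α) over the feasible set {d : d_k ≥ 0 for all k}, then (d⋆, α⋆) defined by d⋆ = λ₁·d* and α⋆ = α*/λ₁ is a local maximizer of the one-parameter criterion Q⋆(λ, d, α) over the same feasible set, and d*_k · α*_{kj} = d⋆_k · α⋆_{kj} for all k, j. -/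
open Finset Real

/-- The two-parameter hierarchical lasso criterion
`Q*(λ₁, λ₂, d, α) = -(1/2) Σᵢ (yᵢ - Σₖ dₖ Σⱼ αₖⱼ xᵢₖⱼ)² - λ₁ Σₖ dₖ - λ₂ Σₖⱼ |αₖⱼ|`. -/
noncomputable def Qtwo {n K : ℕ} {p : Fin K → ℕ} (y : Fin n → ℝ)
    (x : Fin n → (k : Fin K) → Fin (p k) → ℝ) (l1 l2 : ℝ)
    (d : Fin K → ℝ) (a : (k : Fin K) → Fin (p k) → ℝ) : ℝ :=
  -(1 / 2) * ∑ i, (y i - ∑ k, d k * ∑ j, a k j * x i k j) ^ 2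
    - l1 * ∑ k, d k - l2 * ∑ k, ∑ j, |a k j|

/-- The one-parameter hierarchical lasso criterion
`Q⋆(λ, d, α) = -(1/2) Σᵢ (yᵢ - Σₖ dₖ Σⱼ αₖⱼ xᵢₖⱼ)² - Σₖ dₖ - λ Σₖⱼ |αₖⱼ|`. -/
noncomputable def Qone {n K : ℕ} {p : Fin K → ℕ} (y : Fin n → ℝ)
    (x : Fin n → (k : Fin K) → Fin (p k) → ℝ) (l : ℝ)
    (d : Fin K → ℝ) (a : (k : Fin K) → Fin (p k) → ℝ) : ℝ :=
  -(1 / 2) * ∑ i, (y i - ∑ k, d k * ∑ j, a k j * x i k j) ^ 2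
    - ∑ k, d k - l * ∑ k, ∑ j, |a k j|

/-- `(d, a)` is a local maximizer of `Q` over the feasible set `{d : ∀ k, 0 ≤ d k}`:
every feasible point in some neighborhood has criterion value ≤ that of `(d, a)`. -/
def IsFeasLocalMax {K : ℕ} {p : Fin K → ℕ}
    (Q : (Fin K → ℝ) → ((k : Fin K) → Fin (p k) → ℝ) → ℝ)
    (d : Fin K → ℝ) (a : (k : Fin K) → Fin (p k) → ℝ) : Prop :=
  ∃ ε > 0, ∀ (d' : Fin K → ℝ) (a' : (k : Fin K) → Fin (p k) → ℝ),
    (∀ k, 0 ≤ d' k) →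
    dist (⟨d', a'⟩ : (Fin K → ℝ) × ((k : Fin K) → Fin (p k) → ℝ)) ⟨d, a⟩ < ε →
    Q d' a' ≤ Q d a

theorem Qone_eq_Qtwo_aux {n K : ℕ} {p : Fin K → ℕ} (y : Fin n → ℝ)
    (x : Fin n → (k : Fin K) → Fin (p k) → ℝ) (l1 l2 : ℝ) (hl1 : 0 < l1)
    (d : Fin K → ℝ) (a : (k : Fin K) → Fin (p k) → ℝ) :
    Qone y x (l1 * l2) (fun k => l1 * d k) (fun k j => a k j / l1) = Qtwo y x l1 l2 d a := by
  have h0 : l1 ≠ 0 := hl1.ne'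
  have h1 : ∀ i k, l1 * d k * ∑ j, a k j / l1 * x i k j = d k * ∑ j, a k j * x i k j := by
    intro i k
    rw [Finset.mul_sum, Finset.mul_sum]
    refine Finset.sum_congr rfl fun j _ => ?_
    field_simp
  have h2 : l1 * l2 * ∑ k, ∑ j, |a k j / l1| = l2 * ∑ k, ∑ j, |a k j| := by
    simp only [abs_div, abs_of_pos hl1, ← Finset.sum_div]
    field_simp
  unfold Qone Qtwo
  simp only [h1, h2, ← Finset.mul_sum]

/-- If `(d*, α*)` is a feasible local maximizer of the two-parameter criterion
`Q*(λ₁, λ₂, ·, ·)`, then `(λ₁ d*, α*/λ₁)` is a feasible local maximizer of the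
one-parameter criterion `Q⋆(λ₁λ₂, ·, ·)`, and the products `d_k α_{kj}` agree. -/
theorem hierarchical_lasso_two_to_one (n K : ℕ) (p : Fin K → ℕ)
    (y : Fin n → ℝ) (x : Fin n → (k : Fin K) → Fin (p k) → ℝ)
    (l1 l2 : ℝ) (hl1 : 0 < l1) (hl2 : 0 < l2)
    (dstar : Fin K → ℝ) (astar : (k : Fin K) → Fin (p k) → ℝ)
    (hfeas : ∀ k, 0 ≤ dstar k)
    (hmax : IsFeasLocalMax (Qtwo y x l1 l2) dstar astar) :
    (∀ k, 0 ≤ l1 * dstar k) ∧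
    IsFeasLocalMax (Qone y x (l1 * l2)) (fun k => l1 * dstar k)
      (fun k j => astar k j / l1) ∧
    (∀ k j, dstar k * astar k j = (l1 * dstar k) * (astar k j / l1)) := by
  refine ⟨fun k => mul_nonneg hl1.le (hfeas k), ?_, fun k j => by field_simp⟩
  have h0 : l1 ≠ 0 := hl1.ne'
  obtain ⟨ε, hε, H⟩ := hmax
  let F : (Fin K → ℝ) × ((k : Fin K) → Fin (p k) → ℝ) →
      (Fin K → ℝ) × ((k : Fin K) → Fin (p k) → ℝ) :=
    fun z => (fun k => z.1 k / l1, fun k j => l1 * z.2 k j)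
  have hF : Continuous F := by fun_prop
  have hF0 : F (fun k => l1 * dstar k, fun k j => astar k j / l1) = (dstar, astar) := by
    refine Prod.ext (funext fun k => ?_) (funext fun k => funext fun j => ?_)
    · change l1 * dstar k / l1 = dstar k
      field_simp
    · change l1 * (astar k j / l1) = astar k j
      field_simp
  obtain ⟨δ, hδ, hd⟩ := Metric.continuous_iff.1 hF
    (fun k => l1 * dstar k, fun k j => astar k j / l1) ε hε
  refine ⟨δ, hδ, fun d' a' hd' hdist => ?_⟩
  have h1 := hd (d', a') hdist
  rw [hF0] at h1
  have h2 := H _ _ (fun k => div_nonneg (hd' k) hl1.le) h1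
  rw [← Qone_eq_Qtwo_aux y x l1 l2 hl1, ← Qone_eq_Qtwo_aux y x l1 l2 hl1] at h2
  have e1 : (fun k => l1 * (d' k / l1)) = d' := by
    funext k; field_simp
  have e2 : (fun k j => l1 * a' k j / l1) = a' := by
    funext k j; field_simp
  rw [e1, e2] at h2
  exact h2
end

section
/- Fix data y ∈ ℝⁿ and predictors x_{i,kj} (i = 1,…,n; groups k = 1,…,K with p_k variables each). Let λ₁ > 0, λ₂ > 0 and set λ = λ₁λ₂. If (d⋆, α⋆) with d⋆_k ≥ 0 for all k is a local maximizer of the one-parameter hierarchical lasso criterion Q⋆(λ, d, α) over the feasible set {d : d_k ≥ 0 for all k}, then (d*, α*) defined by d* = d⋆/λ₁ and α* = λ₁·α⋆ is a local maximizer of the two-parameter criterion Q*(λ₁, λ₂, d, α) over the same feasible set, and d*_k · α*_{kj} = d⋆_k · α⋆_{kj} for all k, j. -/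
open Finset Real

/-- If `(d⋆, α⋆)` is a feasible local maximizer of the one-parameter criterion
`Q⋆(λ₁λ₂, ·, ·)`, then `(d⋆/λ₁, λ₁ α⋆)` is a feasible local maximizer of the
two-parameter criterion `Q*(λ₁, λ₂, ·, ·)`, and the products `d_k α_{kj}` agree. -/
theorem hierarchical_lasso_one_to_two (n K : ℕ) (p : Fin K → ℕ)
    (y : Fin n → ℝ) (x : Fin n → (k : Fin K) → Fin (p k) → ℝ)
    (l1 l2 : ℝ) (hl1 : 0 < l1) (hl2 : 0 < l2)
    (dst : Fin K → ℝ) (ast : (k : Fin K) → Fin (p k) → ℝ)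
    (hfeas : ∀ k, 0 ≤ dst k)
    (hmax : IsFeasLocalMax (Qone y x (l1 * l2)) dst ast) :
    (∀ k, 0 ≤ dst k / l1) ∧
    IsFeasLocalMax (Qtwo y x l1 l2) (fun k => dst k / l1)
      (fun k j => l1 * ast k j) ∧
    (∀ k j, (dst k / l1) * (l1 * ast k j) = dst k * ast k j) := by
  have key : ∀ (d : Fin K → ℝ) (a : (k : Fin K) → Fin (p k) → ℝ),
      Qtwo y x l1 l2 d a
        = Qone y x (l1 * l2) (fun k => l1 * d k) (fun k j => l1⁻¹ * a k j) := by
    intro d a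
    have h1 : ∀ i, ∑ k, (l1 * d k) * ∑ j, (l1⁻¹ * a k j) * x i k j
        = ∑ k, d k * ∑ j, a k j * x i k j := by
      intro i
      refine Finset.sum_congr rfl fun k _ => ?_
      have h : ∑ j, (l1⁻¹ * a k j) * x i k j = l1⁻¹ * ∑ j, a k j * x i k j := by
        rw [Finset.mul_sum]
        exact Finset.sum_congr rfl fun j _ => by ring
      rw [h]
      field_simp
    have h2 : ∑ k, ∑ j, |l1⁻¹ * a k j| = l1⁻¹ * ∑ k, ∑ j, |a k j| := by
      simp only [abs_mul, abs_of_pos (inv_pos.mpr hl1), Finset.mul_sum]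
    unfold Qtwo Qone
    simp only [h1, h2, ← Finset.mul_sum]
    field_simp
  refine ⟨fun k => div_nonneg (hfeas k) hl1.le, ?_, fun k j => by field_simp⟩
  obtain ⟨ε, hε, H⟩ := hmax
  let f : (Fin K → ℝ) × ((k : Fin K) → Fin (p k) → ℝ) →
      (Fin K → ℝ) × ((k : Fin K) → Fin (p k) → ℝ) :=
    fun z => (fun k => l1 * z.1 k, fun k j => l1⁻¹ * z.2 k j)
  have hf : Continuous f := by
    refine Continuous.prodMk ?_ ?_
    · fun_prop
    · fun_prop
  have e1 : (fun k => l1 * (dst k / l1)) = dst := by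
    funext k
    field_simp
  have e2 : (fun k j => l1⁻¹ * (l1 * ast k j)) = ast := by
    funext k j
    field_simp
  have hf0 : f (fun k => dst k / l1, fun k j => l1 * ast k j) = (dst, ast) :=
    Prod.ext e1 e2
  obtain ⟨δ, hδ, hd⟩ := Metric.continuous_iff.mp hf
    (fun k => dst k / l1, fun k j => l1 * ast k j) ε hε
  refine ⟨δ, hδ, fun d' a' hd' hdist => ?_⟩
  rw [key, key, e1, e2]
  refine H _ _ (fun k => mul_nonneg hl1.le (hd' k)) ?_
  have := hd (d', a') hdist
  rw [hf0] at this
  exact this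
end

section
/- For all λ₁ > 0, λ₂ ≥ 0, all d ∈ ℝ^K and α, the identity Q*(λ₁, λ₂, d, α) = Q⋆(λ₁λ₂, λ₁·d, α/λ₁) holds, where Q* is the two-parameter hierarchical lasso criterion and Q⋆ is the one-parameter criterion built from the same data. -/
open Finset Real

/-- For all `λ₁ > 0`, `λ₂ ≥ 0`, and all `(d, α)`, the identity
`Q*(λ₁, λ₂, d, α) = Q⋆(λ₁λ₂, λ₁·d, α/λ₁)` holds. -/
theorem hierarchical_lasso_criterion_identity (n K : ℕ) (p : Fin K → ℕ)
    (y : Fin n → ℝ) (x : Fin n → (k : Fin K) → Fin (p k) → ℝ)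
    (l1 l2 : ℝ) (hl1 : 0 < l1) (hl2 : 0 ≤ l2)
    (d : Fin K → ℝ) (a : (k : Fin K) → Fin (p k) → ℝ) :
    Qtwo y x l1 l2 d a =
      Qone y x (l1 * l2) (fun k => l1 * d k) (fun k j => a k j / l1) := by
  have h0 : l1 ≠ 0 := hl1.ne'
  have h1 : ∀ i k, (l1 * d k) * ∑ j, a k j / l1 * x i k j = d k * ∑ j, a k j * x i k j := by
    intro i k
    rw [Finset.mul_sum, Finset.mul_sum]
    refine Finset.sum_congr rfl fun j _ => ?_
    field_simp
  have h2 : (l1 * l2) * ∑ k, ∑ j, |a k j / l1| = l2 * ∑ k, ∑ j, |a k j| := by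
    simp only [Finset.mul_sum]
    refine Finset.sum_congr rfl fun k _ => Finset.sum_congr rfl fun j _ => ?_
    rw [abs_div, abs_of_pos hl1]
    field_simp
  unfold Qtwo Qone
  simp only [h1]
  rw [h2, ← Finset.mul_sum]
end

section
/- Fix data y ∈ ℝⁿ and predictors x_{i,kj} (groups k = 1,…,K with p_k variables each) and let λ > 0. Suppose (d̂, α̂) with d̂_k ≥ 0 for all k is a local maximizer of the one-parameter hierarchical lasso criterion Q⋆(λ, d, α) over {d : d_k ≥ 0}, and set β̂_{kj} = d̂_k · α̂_{kj}. Then for every group k: (i) if d̂_k = 0 then α̂_{kj} = 0 for all j; (ii) if d̂_k ≠ 0 then ‖β̂_k‖₁ ≠ 0, d̂_k = √(λ‖β̂_k‖₁), and α̂_{kj} = β̂_{kj}/√(λ‖β̂_k‖₁) for all j, where ‖β̂_k‖₁ = Σ_{j=1}^{p_k} |β̂_{kj}|. -/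
open Finset Real

open Filter Topology in
lemma aux_move (n K : ℕ) (p : Fin K → ℕ)
    (y : Fin n → ℝ) (x : Fin n → (k : Fin K) → Fin (p k) → ℝ)
    (lam : ℝ) (d : Fin K → ℝ) (a : (k : Fin K) → Fin (p k) → ℝ)
    (hfeas : ∀ k, 0 ≤ d k) (hmax : IsFeasLocalMax (Qone y x lam) d a) (k : Fin K) :
    ∀ᶠ q : ℝ × ℝ in 𝓝 (1, 1), q.1 * q.2 * d k = d k →
      d k + lam * ∑ j, |a k j| ≤ q.1 * d k + lam * (q.2 * ∑ j, |a k j|) := by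
  obtain ⟨ε, hε, h⟩ := hmax
  let F : ℝ × ℝ → (Fin K → ℝ) × ((k : Fin K) → Fin (p k) → ℝ) := fun q =>
    (fun k' => (if k' = k then q.1 else 1) * d k',
     fun k' j => (if k' = k then q.2 else 1) * a k' j)
  have hF : Continuous F := by
    refine Continuous.prodMk ?_ ?_
    · refine continuous_pi fun k' => ?_
      split_ifs <;> fun_prop
    · refine continuous_pi fun k' => continuous_pi fun j => ?_
      split_ifs <;> fun_prop
  have hF1 : F (1, 1) = (d, a) := by simp [F]
  have e1 : ∀ᶠ q in 𝓝 ((1 : ℝ), (1 : ℝ)), dist (F q) (d, a) < ε := by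
    have := hF.tendsto (1, 1)
    rw [hF1] at this
    exact this (Metric.ball_mem_nhds _ hε)
  have e2 : ∀ᶠ q in 𝓝 ((1 : ℝ), (1 : ℝ)), 0 < q.1 :=
    (continuous_fst.tendsto ((1 : ℝ), (1 : ℝ))).eventually (lt_mem_nhds one_pos)
  have e3 : ∀ᶠ q in 𝓝 ((1 : ℝ), (1 : ℝ)), 0 < q.2 :=
    (continuous_snd.tendsto ((1 : ℝ), (1 : ℝ))).eventually (lt_mem_nhds one_pos)
  filter_upwards [e1, e2, e3] with q h1 h2 h3 hq
  have key : ∀ (u : ℝ) (g : Fin K → ℝ),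
      ∑ k', (if k' = k then u else 1) * g k' = ∑ k', g k' + (u - 1) * g k := by
    intro u g
    have : ∀ k', (if k' = k then u else 1) * g k' = g k' + if k' = k then (u - 1) * g k' else 0 := by
      intro k'
      split_ifs <;> ring
    simp [this, Finset.sum_add_distrib]
  have hh := h (F q).1 (F q).2 (fun k' => by
    refine mul_nonneg ?_ (hfeas k')
    split_ifs
    · exact h2.le
    · exact zero_le_one) h1
  have f1 : ∀ i, ∑ k', (F q).1 k' * ∑ j, (F q).2 k' j * x i k' j
      = ∑ k', d k' * ∑ j, a k' j * x i k' j := by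
    intro i
    refine Finset.sum_congr rfl fun k' _ => ?_
    simp only [F, mul_assoc, ← Finset.mul_sum]
    by_cases hk : k' = k
    · subst hk
      simp only [if_true]
      linear_combination (∑ j, a k' j * x i k' j) * hq
    · simp [hk]
  have f2 : ∑ k', (F q).1 k' = ∑ k', d k' + (q.1 - 1) * d k := key q.1 d
  have f3 : ∑ k', ∑ j, |(F q).2 k' j| = ∑ k', ∑ j, |a k' j| + (q.2 - 1) * ∑ j, |a k j| := by
    rw [← key q.2 (fun k' => ∑ j, |a k' j|)]
    refine Finset.sum_congr rfl fun k' _ => ?_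
    rw [Finset.mul_sum]
    refine Finset.sum_congr rfl fun j _ => ?_
    simp only [F, abs_mul]
    split_ifs
    · rw [abs_of_pos h3]
    · simp
  unfold Qone at hh
  simp only [f1, f2, f3] at hh
  linarith

/-- Structure of local maximizers of the one-parameter hierarchical lasso criterion:
with `β̂_{kj} = d̂_k α̂_{kj}`, for every group `k`, if `d̂_k = 0` then `α̂_k = 0`, and
if `d̂_k ≠ 0` then `‖β̂_k‖₁ ≠ 0`, `d̂_k = √(λ‖β̂_k‖₁)`, and
`α̂_{kj} = β̂_{kj} / √(λ‖β̂_k‖₁)`. -/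
theorem hierarchical_lasso_local_max_structure (n K : ℕ) (p : Fin K → ℕ)
    (y : Fin n → ℝ) (x : Fin n → (k : Fin K) → Fin (p k) → ℝ)
    (lam : ℝ) (hlam : 0 < lam)
    (dhat : Fin K → ℝ) (ahat : (k : Fin K) → Fin (p k) → ℝ)
    (hfeas : ∀ k, 0 ≤ dhat k)
    (hmax : IsFeasLocalMax (Qone y x lam) dhat ahat)
    (bhat : (k : Fin K) → Fin (p k) → ℝ)
    (hbhat : ∀ k j, bhat k j = dhat k * ahat k j) :
    ∀ k, (dhat k = 0 → ∀ j, ahat k j = 0) ∧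
      (dhat k ≠ 0 →
        (∑ j, |bhat k j|) ≠ 0 ∧
        dhat k = Real.sqrt (lam * ∑ j, |bhat k j|) ∧
        ∀ j, ahat k j = bhat k j / Real.sqrt (lam * ∑ j', |bhat k j'|)) := by
  intro k
  have hm := aux_move n K p y x lam dhat ahat hfeas hmax k
  have hA : 0 ≤ ∑ j, |ahat k j| := Finset.sum_nonneg fun j _ => abs_nonneg _
  have hB : ∑ j, |bhat k j| = dhat k * ∑ j, |ahat k j| := by
    rw [Finset.mul_sum]
    refine Finset.sum_congr rfl fun j _ => ?_
    rw [hbhat, abs_mul, abs_of_nonneg (hfeas k)]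
  refine ⟨fun h0 => ?_, fun h0 => ?_⟩
  · have hc : Filter.Tendsto (fun s : ℝ => ((1 : ℝ), s)) (nhds 1) (nhds (1, 1)) :=
      Continuous.tendsto (by fun_prop) 1
    have hs := hc.eventually hm
    obtain ⟨s, hs, hs1⟩ := ((hs.filter_mono nhdsWithin_le_nhds).and
      (self_mem_nhdsWithin (a := (1 : ℝ)) (s := Set.Iio 1))).exists
    have hs1 : s < 1 := hs1
    have h2 := hs (by simp [h0])
    simp only [h0, mul_zero, zero_add] at h2
    have h3 := le_of_mul_le_mul_left h2 hlam
    have h4 : ∑ j, |ahat k j| = 0 := by nlinarith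
    intro j
    have := (Finset.sum_eq_zero_iff_of_nonneg (fun j _ => abs_nonneg _)).1 h4 j (Finset.mem_univ j)
    exact abs_eq_zero.1 this
  · have hd : 0 < dhat k := lt_of_le_of_ne (hfeas k) (Ne.symm h0)
    have hc : Filter.Tendsto (fun s : ℝ => (s, s⁻¹)) (nhds 1) (nhds (1, 1)) := by
      have h1 : ContinuousAt (fun s : ℝ => (s, s⁻¹)) 1 :=
        continuousAt_id.prodMk (continuousAt_inv₀ one_ne_zero)
      simpa [ContinuousAt] using h1
    have hs := hc.eventually hm
    have hmin : IsLocalMin (fun s : ℝ => s * dhat k + lam * (s⁻¹ * ∑ j, |ahat k j|)) 1 := by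
      filter_upwards [hs, lt_mem_nhds (one_pos : (0 : ℝ) < 1)] with s h1 h2
      have := h1 (by rw [mul_inv_cancel₀ h2.ne', one_mul])
      simpa using this
    have hder := ((hasDerivAt_id (1 : ℝ)).mul_const (dhat k)).add
      (((hasDerivAt_inv (one_ne_zero : (1 : ℝ) ≠ 0)).mul_const (∑ j, |ahat k j|)).const_mul lam)
    have hz := hmin.hasDerivAt_eq_zero hder
    have hdA : dhat k = lam * ∑ j, |ahat k j| := by
      norm_num at hz
      linarith
    have hA0 : ∑ j, |ahat k j| ≠ 0 := by
      intro h
      rw [h, mul_zero] at hdA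
      exact h0 hdA
    have hsq : Real.sqrt (lam * ∑ j, |bhat k j|) = dhat k := by
      have : lam * ∑ j, |bhat k j| = dhat k ^ 2 := by
        rw [hB]
        linear_combination (-dhat k) * hdA
      rw [this, Real.sqrt_sq hd.le]
    refine ⟨?_, hsq.symm, fun j => ?_⟩
    · rw [hB]
      exact mul_ne_zero h0 hA0
    · rw [hsq, hbhat, mul_div_cancel_left₀ _ h0]
end

section
/- Fix data y ∈ ℝⁿ and predictors x_{i,kj} (groups k = 1,…,K with p_k variables each) and let λ > 0. If (d̂, α̂) with d̂_k ≥ 0 for all k is a local maximizer of the one-parameter hierarchical lasso criterion Q⋆(λ, d, α) over {d : d_k ≥ 0}, then the vector β̂ defined by β̂_{kj} = d̂_k · α̂_{kj} is a local maximizer of the square-root-L1 group criterion Q(λ, β) = −(1/2) Σ_{i=1}^n (y_i − Σ_{k=1}^K Σ_{j=1}^{p_k} x_{i,kj} β_{kj})² − 2√λ Σ_{k=1}^K √(‖β_k‖₁) over all β. -/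
open Finset Real

/-- The square-root-L1 group criterion
`Q(λ, β) = -(1/2) Σᵢ (yᵢ - Σₖⱼ xᵢₖⱼ βₖⱼ)² - 2√λ Σₖ √(‖βₖ‖₁)`. -/
noncomputable def Qbeta {n K : ℕ} {p : Fin K → ℕ} (y : Fin n → ℝ)
    (x : Fin n → (k : Fin K) → Fin (p k) → ℝ) (l : ℝ)
    (b : (k : Fin K) → Fin (p k) → ℝ) : ℝ :=
  -(1 / 2) * ∑ i, (y i - ∑ k, ∑ j, x i k j * b k j) ^ 2
    - 2 * Real.sqrt l * ∑ k, Real.sqrt (∑ j, |b k j|)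

lemma Qone_le_scale {n K : ℕ} {p : Fin K → ℕ}
    (y : Fin n → ℝ) (x : Fin n → (k : Fin K) → Fin (p k) → ℝ)
    (lam : ℝ) 
    (d : Fin K → ℝ) (a : (k : Fin K) → Fin (p k) → ℝ) (k : Fin K) (t : ℝ) (ht : 0 < t) :
    Qone y x lam (fun k' => (if k' = k then t else 1) * d k')
      (fun k' j => (if k' = k then t⁻¹ else 1) * a k' j)
      = Qone y x lam d a - ((t - 1) * d k + lam * ((t⁻¹ - 1) * ∑ j, |a k j|)) := by
  unfold Qone
  have h1 : ∀ i, ∑ k', (if k' = k then t else 1) * d k' *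
      ∑ j, (if k' = k then t⁻¹ else 1) * a k' j * x i k' j
      = ∑ k', d k' * ∑ j, a k' j * x i k' j := by
    intro i
    refine Finset.sum_congr rfl fun k' _ => ?_
    simp only [mul_assoc, ← Finset.mul_sum]
    split_ifs
    · field_simp
    · simp
  have h2 : ∑ k', (if k' = k then t else 1) * d k' = ∑ k', d k' + (t - 1) * d k := by
    have : ∀ k', (if k' = k then t else 1) * d k'
        = d k' + if k' = k then (t - 1) * d k' else 0 := by
      intro k'; split_ifs <;> ring
    simp [this, Finset.sum_add_distrib]
  have h3 : ∑ k', ∑ j, |(if k' = k then t⁻¹ else 1) * a k' j|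
      = ∑ k', ∑ j, |a k' j| + (t⁻¹ - 1) * ∑ j, |a k j| := by
    have : ∀ k', ∑ j, |(if k' = k then t⁻¹ else 1) * a k' j|
        = ∑ j, |a k' j| + if k' = k then (t⁻¹ - 1) * ∑ j, |a k' j| else 0 := by
      intro k'
      simp only [abs_mul, ← Finset.mul_sum]
      split_ifs
      · rw [abs_of_pos (inv_pos.2 ht)]; ring
      · simp
    simp only [this, Finset.sum_add_distrib]
    simp
  simp only [h1, h2, h3]
  ring

lemma balance {n K : ℕ} {p : Fin K → ℕ}
    (y : Fin n → ℝ) (x : Fin n → (k : Fin K) → Fin (p k) → ℝ)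
    (lam : ℝ) (d : Fin K → ℝ) (a : (k : Fin K) → Fin (p k) → ℝ)
    (hfeas : ∀ k, 0 ≤ d k)
    (hmax : IsFeasLocalMax (Qone y x lam) d a) (k : Fin K) :
    d k = lam * ∑ j, |a k j| := by
  obtain ⟨ε, hε, H⟩ := hmax
  let g : ℝ → (Fin K → ℝ) × ((k : Fin K) → Fin (p k) → ℝ) := fun t =>
    (fun k' => (if k' = k then t else 1) * d k',
      fun k' j => (if k' = k then t⁻¹ else 1) * a k' j)
  have hg : ContinuousAt g 1 := by
    refine ContinuousAt.prodMk ?_ ?_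
    · refine continuousAt_pi.2 fun k' => ?_
      split_ifs <;> fun_prop
    · refine continuousAt_pi.2 fun k' => continuousAt_pi.2 fun j => ?_
      split_ifs
      · exact (continuousAt_inv₀ one_ne_zero).mul continuousAt_const
      · fun_prop
  have hg1 : g 1 = (d, a) := by simp [g]
  have hev : ∀ᶠ t in nhds (1:ℝ), dist (g t) (d, a) < ε := by
    have := Metric.tendsto_nhds.1 hg ε hε
    rwa [hg1] at this
  have hmin : IsLocalMin (fun t : ℝ => (t - 1) * d k + lam * ((t⁻¹ - 1) * ∑ j, |a k j|)) 1 := by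
    filter_upwards [hev, lt_mem_nhds (zero_lt_one : (0:ℝ) < 1)] with t h1 h2
    have h3 := H (g t).1 (g t).2 (fun k' => by
      have := hfeas k'
      simp only [g]
      split_ifs <;> positivity) h1
    have h4 := Qone_le_scale y x lam d a k t h2
    simp only [g] at h3
    rw [h4] at h3
    norm_num
    linarith
  have hd : HasDerivAt (fun t : ℝ => (t - 1) * d k + lam * ((t⁻¹ - 1) * ∑ j, |a k j|))
      (1 * d k + lam * ((-(1 ^ 2)⁻¹) * ∑ j, |a k j|)) 1 := by
    refine (((hasDerivAt_id (1:ℝ)).sub_const 1).mul_const _).add ?_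
    exact (((hasDerivAt_inv one_ne_zero).sub_const 1).mul_const _).const_mul _
  have := hmin.hasDerivAt_eq_zero hd
  norm_num at this
  linarith

lemma Qone_phi {n K : ℕ} {p : Fin K → ℕ}
    (y : Fin n → ℝ) (x : Fin n → (k : Fin K) → Fin (p k) → ℝ)
    (lam : ℝ) (hlam : 0 < lam) (b : (k : Fin K) → Fin (p k) → ℝ) :
    Qone y x lam (fun k => √(lam * ∑ j, |b k j|))
      (fun k j => b k j / √(lam * ∑ j, |b k j|)) = Qbeta y x lam b := by
  have hS : ∀ k, 0 ≤ ∑ j, |b k j| := fun k => Finset.sum_nonneg fun j _ => abs_nonneg _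
  have hz : ∀ k, √(lam * ∑ j, |b k j|) = 0 → ∀ j, b k j = 0 := by
    intro k h j
    rw [Real.sqrt_eq_zero (mul_nonneg hlam.le (hS k))] at h
    have h' := (mul_eq_zero.1 h).resolve_left hlam.ne'
    rw [Finset.sum_eq_zero_iff_of_nonneg (fun j _ => abs_nonneg _)] at h'
    exact abs_eq_zero.1 (h' j (Finset.mem_univ _))
  unfold Qone Qbeta
  have h1 : ∀ i, ∑ k, √(lam * ∑ j, |b k j|) * ∑ j, b k j / √(lam * ∑ j, |b k j|) * x i k j
      = ∑ k, ∑ j, x i k j * b k j := by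
    intro i
    refine Finset.sum_congr rfl fun k _ => ?_
    rw [Finset.mul_sum]
    refine Finset.sum_congr rfl fun j _ => ?_
    by_cases h : √(lam * ∑ j, |b k j|) = 0
    · simp [hz k h j]
    · field_simp
  have h2 : ∀ k, √(lam * ∑ j, |b k j|) = √lam * √(∑ j, |b k j|) := fun k =>
    Real.sqrt_mul hlam.le _
  have h3 : ∀ k, lam * ∑ j, |b k j / √(lam * ∑ j, |b k j|)| = √lam * √(∑ j, |b k j|) := by
    intro k
    rw [← h2]
    simp only [abs_div, ← Finset.sum_div]
    rw [abs_of_nonneg (Real.sqrt_nonneg _), ← mul_div_assoc, Real.div_sqrt]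
  simp only [h1]
  rw [Finset.mul_sum univ _ lam]
  simp only [h3]
  simp only [h2, ← Finset.mul_sum]
  ring

lemma phi_cont {K : ℕ} {p : Fin K → ℕ} (lam : ℝ) (hlam : 0 < lam) :
    Continuous (fun b : (k : Fin K) → Fin (p k) → ℝ =>
      ((fun k => √(lam * ∑ j, |b k j|), fun k j => b k j / √(lam * ∑ j, |b k j|)) :
        (Fin K → ℝ) × ((k : Fin K) → Fin (p k) → ℝ))) := by
  refine Continuous.prodMk (by fun_prop) ?_
  refine continuous_pi fun k => continuous_pi fun j => ?_
  have hc : Continuous (fun b : (k : Fin K) → Fin (p k) → ℝ => √(lam * ∑ j, |b k j|)) := by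
    fun_prop
  have hb : Continuous (fun b : (k : Fin K) → Fin (p k) → ℝ => b k j) := by fun_prop
  rw [continuous_iff_continuousAt]
  intro b
  by_cases h : √(lam * ∑ j, |b k j|) = 0
  · have hle : ∀ b' : (k : Fin K) → Fin (p k) → ℝ,
        |b' k j / √(lam * ∑ j, |b' k j|)| ≤ lam⁻¹ * √(lam * ∑ j, |b' k j|) := by
      intro b'
      have hj : |b' k j| ≤ ∑ j, |b' k j| :=
        Finset.single_le_sum (f := fun j => |b' k j|) (fun j _ => abs_nonneg _)
          (Finset.mem_univ j)
      have e : lam⁻¹ * √(lam * ∑ j, |b' k j|)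
          = (∑ j, |b' k j|) / √(lam * ∑ j, |b' k j|) := by
        conv_lhs => rw [← Real.div_sqrt]
        field_simp
      rw [e, abs_div, abs_of_nonneg (Real.sqrt_nonneg _)]
      gcongr
    unfold ContinuousAt
    simp only [h, div_zero]
    refine squeeze_zero_norm hle ?_
    have := (hc.const_mul lam⁻¹).tendsto b
    simpa [h] using this
  · exact hb.continuousAt.div hc.continuousAt h

/-- (Theorem 1, first direction.) If `(d̂, α̂)` is a feasible local maximizer of
the one-parameter hierarchical lasso criterion `Q⋆(λ, ·, ·)`, then
`β̂ = (d̂_k α̂_{kj})` is a local maximizer of the square-root-L1 group criterion. -/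
theorem hierarchical_lasso_to_sqrtL1 (n K : ℕ) (p : Fin K → ℕ)
    (y : Fin n → ℝ) (x : Fin n → (k : Fin K) → Fin (p k) → ℝ)
    (lam : ℝ) (hlam : 0 < lam)
    (dhat : Fin K → ℝ) (ahat : (k : Fin K) → Fin (p k) → ℝ)
    (hfeas : ∀ k, 0 ≤ dhat k)
    (hmax : IsFeasLocalMax (Qone y x lam) dhat ahat)
    (bhat : (k : Fin K) → Fin (p k) → ℝ)
    (hbhat : ∀ k j, bhat k j = dhat k * ahat k j) :
    ∃ ε > 0, ∀ b : (k : Fin K) → Fin (p k) → ℝ,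
      dist b bhat < ε → Qbeta y x lam b ≤ Qbeta y x lam bhat := by
  have hbal := balance y x lam dhat ahat hfeas hmax
  have hd : ∀ k, √(lam * ∑ j, |bhat k j|) = dhat k := by
    intro k
    have : lam * ∑ j, |bhat k j| = dhat k ^ 2 := by
      simp only [hbhat, abs_mul, ← Finset.mul_sum, abs_of_nonneg (hfeas k)]
      rw [mul_left_comm, ← hbal k]; ring
    rw [this, Real.sqrt_sq (hfeas k)]
  have ha : ∀ k j, bhat k j / √(lam * ∑ j, |bhat k j|) = ahat k j := by
    intro k j
    rw [hd, hbhat]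
    by_cases h : dhat k = 0
    · have h' := (hbal k).symm
      rw [h] at h'
      have h'' := (mul_eq_zero.1 h').resolve_left hlam.ne'
      rw [Finset.sum_eq_zero_iff_of_nonneg (fun j _ => abs_nonneg _)] at h''
      rw [h, abs_eq_zero.1 (h'' j (Finset.mem_univ _))]
      simp
    · field_simp
  simp only [hd] at ha
  obtain ⟨ε, hε, H⟩ := hmax
  obtain ⟨δ, hδ, hcont⟩ := Metric.continuousAt_iff.1
    ((phi_cont (p := p) lam hlam).continuousAt (x := bhat)) ε hε
  refine ⟨δ, hδ, fun b hb => ?_⟩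
  have h1 := hcont hb
  simp only [ha, hd] at h1
  have h2 := H _ _ (fun k => Real.sqrt_nonneg _) h1
  rw [Qone_phi y x lam hlam b] at h2
  have h3 := Qone_phi y x lam hlam bhat
  simp only [ha, hd] at h3
  rw [← h3]
  exact h2
end

section
/- Fix data y ∈ ℝⁿ and predictors x_{i,kj} (groups k = 1,…,K with p_k variables each) and let λ > 0. Suppose β̂ is a local maximizer of the square-root-L1 group criterion Q(λ, β) = −(1/2) Σ_i (y_i − Σ_{k,j} x_{i,kj} β_{kj})² − 2√λ Σ_k √(‖β̂_k‖₁). Define (d̂, α̂) by: d̂_k = 0 and α̂_k = 0 if ‖β̂_k‖₁ = 0; and d̂_k = √(λ‖β̂_k‖₁) and α̂_k = β̂_k / √(λ‖β̂_k‖₁) if ‖β̂_k‖₁ ≠ 0. Then (d̂, α̂) is a local maximizer of the one-parameter hierarchical lasso criterion Q⋆(λ, d, α) over {d : d_k ≥ 0 for all k}. -/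
open Finset Real

lemma quad_eq_aux {n K : ℕ} {p : Fin K → ℕ} (y : Fin n → ℝ)
    (x : Fin n → (k : Fin K) → Fin (p k) → ℝ)
    (d : Fin K → ℝ) (a : (k : Fin K) → Fin (p k) → ℝ) :
    ∑ i, (y i - ∑ k, ∑ j, x i k j * (d k * a k j)) ^ 2
      = ∑ i, (y i - ∑ k, d k * ∑ j, a k j * x i k j) ^ 2 := by
  refine Finset.sum_congr rfl fun i _ => ?_
  congr 2
  refine Finset.sum_congr rfl fun k _ => ?_
  rw [Finset.mul_sum]
  exact Finset.sum_congr rfl fun j _ => by ring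

lemma amgm_aux (l d s : ℝ) (hl : 0 < l) (hd : 0 ≤ d) (hs : 0 ≤ s) :
    2 * √l * √(d * s) ≤ d + l * s := by
  rw [Real.sqrt_mul hd]
  have h1 := Real.sq_sqrt hd
  have h2 := Real.sq_sqrt hs
  have h3 := Real.sq_sqrt hl.le
  have h : d + l * s - 2 * √l * (√d * √s) = (√d - √l * √s) ^ 2 := by
    rw [sub_sq, mul_pow, h1, h2, h3]; ring
  nlinarith [sq_nonneg (√d - √l * √s)]

lemma abs_sum_aux {m : ℕ} (d : ℝ) (hd : 0 ≤ d) (a : Fin m → ℝ) :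
    ∑ j, |d * a j| = d * ∑ j, |a j| := by
  rw [Finset.mul_sum]
  exact Finset.sum_congr rfl fun j _ => by rw [abs_mul, abs_of_nonneg hd]

/-- (Theorem 1, second direction.) If `β̂` is a local maximizer of the
square-root-L1 group criterion, then `(d̂, α̂)` defined by `d̂_k = 0, α̂_k = 0`
when `‖β̂_k‖₁ = 0` and `d̂_k = √(λ‖β̂_k‖₁)`, `α̂_k = β̂_k / √(λ‖β̂_k‖₁)` when
`‖β̂_k‖₁ ≠ 0`, is a feasible local maximizer of the one-parameter hierarchical
lasso criterion `Q⋆(λ, ·, ·)`. -/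
theorem sqrtL1_to_hierarchical_lasso (n K : ℕ) (p : Fin K → ℕ)
    (y : Fin n → ℝ) (x : Fin n → (k : Fin K) → Fin (p k) → ℝ)
    (lam : ℝ) (hlam : 0 < lam)
    (bhat : (k : Fin K) → Fin (p k) → ℝ)
    (hmax : ∃ ε > 0, ∀ b : (k : Fin K) → Fin (p k) → ℝ,
      dist b bhat < ε → Qbeta y x lam b ≤ Qbeta y x lam bhat)
    (dhat : Fin K → ℝ) (ahat : (k : Fin K) → Fin (p k) → ℝ)
    (hzero : ∀ k, (∑ j, |bhat k j|) = 0 → dhat k = 0 ∧ ∀ j, ahat k j = 0)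
    (hnonzero : ∀ k, (∑ j, |bhat k j|) ≠ 0 →
      dhat k = Real.sqrt (lam * ∑ j, |bhat k j|) ∧
      ∀ j, ahat k j = bhat k j / Real.sqrt (lam * ∑ j', |bhat k j'|)) :
    (∀ k, 0 ≤ dhat k) ∧ IsFeasLocalMax (Qone y x lam) dhat ahat := by
  have hd0 : ∀ k, 0 ≤ dhat k := by
    intro k
    by_cases h : (∑ j, |bhat k j|) = 0
    · exact (hzero k h).1.ge
    · rw [(hnonzero k h).1]; exact Real.sqrt_nonneg _
  refine ⟨hd0, ?_⟩
  have hs0 : ∀ k, 0 ≤ ∑ j, |bhat k j| := fun k => Finset.sum_nonneg fun j _ => abs_nonneg _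
  have hb : (fun k j => dhat k * ahat k j) = bhat := by
    funext k j
    by_cases h : (∑ j, |bhat k j|) = 0
    · have := (Finset.sum_eq_zero_iff_of_nonneg (fun j _ => abs_nonneg (bhat k j))).1 h j
        (Finset.mem_univ j)
      rw [(hzero k h).1, abs_eq_zero.1 this, zero_mul]
    · have hp : 0 < √(lam * ∑ j, |bhat k j|) :=
        Real.sqrt_pos.2 (mul_pos hlam (lt_of_le_of_ne (hs0 k) (Ne.symm h)))
      rw [(hnonzero k h).1, (hnonzero k h).2 j]
      field_simp
  have hpen : ∀ k, dhat k + lam * ∑ j, |ahat k j| = 2 * √lam * √(∑ j, |bhat k j|) := by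
    intro k
    by_cases h : (∑ j, |bhat k j|) = 0
    · rw [h, (hzero k h).1]
      simp [(hzero k h).2]
    · have hp : 0 < √(lam * ∑ j, |bhat k j|) :=
        Real.sqrt_pos.2 (mul_pos hlam (lt_of_le_of_ne (hs0 k) (Ne.symm h)))
      have hsq := Real.sq_sqrt (mul_nonneg hlam.le (hs0 k))
      have hA : dhat k * ∑ j, |ahat k j| = ∑ j, |bhat k j| := by
        rw [← abs_sum_aux _ (hd0 k)]
        exact Finset.sum_congr rfl fun j _ => by rw [← hb]
      have hd := (hnonzero k h).1
      have h2 : 2 * √lam * √(∑ j, |bhat k j|) = 2 * dhat k := by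
        rw [hd, Real.sqrt_mul hlam.le]; ring
      rw [h2]
      rw [← hd] at hp hsq
      have h3 : lam * ∑ j, |ahat k j| = dhat k := by
        apply mul_left_cancel₀ hp.ne'
        calc dhat k * (lam * ∑ j, |ahat k j|) = lam * (dhat k * ∑ j, |ahat k j|) := by ring
          _ = dhat k * dhat k := by rw [hA, ← hsq]; ring
      rw [h3]; ring
  have hle : ∀ (d : Fin K → ℝ) (a : (k : Fin K) → Fin (p k) → ℝ), (∀ k, 0 ≤ d k) →
      Qone y x lam d a ≤ Qbeta y x lam (fun k j => d k * a k j) := by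
    intro d a hd
    unfold Qone Qbeta
    rw [quad_eq_aux]
    have : 2 * √lam * ∑ k, √(∑ j, |d k * a k j|) ≤ ∑ k, d k + lam * ∑ k, ∑ j, |a k j| := by
      rw [Finset.mul_sum, Finset.mul_sum, ← Finset.sum_add_distrib]
      refine Finset.sum_le_sum fun k _ => ?_
      rw [abs_sum_aux _ (hd k)]
      exact amgm_aux _ _ _ hlam (hd k) (Finset.sum_nonneg fun j _ => abs_nonneg _)
    linarith
  have heq : Qone y x lam dhat ahat = Qbeta y x lam bhat := by
    have h1 : 2 * √lam * ∑ k, √(∑ j, |bhat k j|)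
        = ∑ k, dhat k + lam * ∑ k, ∑ j, |ahat k j| := by
      rw [Finset.mul_sum, Finset.mul_sum, ← Finset.sum_add_distrib]
      exact Finset.sum_congr rfl fun k _ => (hpen k).symm
    have h2 := quad_eq_aux y x dhat ahat
    have h3 : ∀ k j, dhat k * ahat k j = bhat k j := fun k j => congrFun (congrFun hb k) j
    simp only [h3] at h2
    unfold Qone Qbeta
    rw [h1, h2]; ring
  obtain ⟨ε, hε, hm⟩ := hmax
  have hc : Continuous (fun q : (Fin K → ℝ) × ((k : Fin K) → Fin (p k) → ℝ) =>
      (fun k j => q.1 k * q.2 k j : (k : Fin K) → Fin (p k) → ℝ)) := by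
    fun_prop
  obtain ⟨δ, hδ, hcd⟩ := Metric.continuous_iff.1 hc (dhat, ahat) ε hε
  refine ⟨δ, hδ, fun d' a' hd' hdist => ?_⟩
  have := hcd (d', a') hdist
  simp only [hb] at this
  rw [heq]
  exact (hle d' a' hd').trans (hm _ this)
end

section
/- Let λ > 0 and let β = (β_1,…,β_K) be a grouped vector with β_k ∈ ℝ^{p_k}. Then the minimum of Σ_{k=1}^K d_k + λ Σ_{k=1}^K Σ_{j=1}^{p_k} |α_{kj}| over all (d, α) with d_k ≥ 0 and d_k·α_{kj} = β_{kj} for all k, j equals 2√λ Σ_{k=1}^K √(‖β_k‖₁); the minimum is attained by taking d_k = 0, α_k = 0 for groups with β_k = 0, and d_k = √(λ‖β_k‖₁), α_k = β_k/√(λ‖β_k‖₁) for groups with β_k ≠ 0. -/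
open Finset Real

/-- Grouped identity for the hierarchical lasso penalty: the minimum of
`Σₖ dₖ + λ Σₖⱼ |αₖⱼ|` over `(d, α)` with `dₖ ≥ 0` and `dₖ αₖⱼ = βₖⱼ` equals
`2√λ Σₖ √(‖βₖ‖₁)`; it is attained by taking `dₖ = 0, αₖ = 0` on groups with
`βₖ = 0`, and `dₖ = √(λ‖βₖ‖₁)`, `αₖ = βₖ/√(λ‖βₖ‖₁)` on groups with `βₖ ≠ 0`. -/
theorem grouped_penalty_min (K : ℕ) (p : Fin K → ℕ) (lam : ℝ) (hlam : 0 < lam)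
    (beta : (k : Fin K) → Fin (p k) → ℝ) :
    (∀ (d : Fin K → ℝ) (alpha : (k : Fin K) → Fin (p k) → ℝ),
        (∀ k, 0 ≤ d k) → (∀ k j, d k * alpha k j = beta k j) →
        2 * Real.sqrt lam * ∑ k, Real.sqrt (∑ j, |beta k j|) ≤
          (∑ k, d k) + lam * ∑ k, ∑ j, |alpha k j|) ∧
    (∃ (d : Fin K → ℝ) (alpha : (k : Fin K) → Fin (p k) → ℝ),
        (∀ k, 0 ≤ d k) ∧ (∀ k j, d k * alpha k j = beta k j) ∧
        (∀ k, (∀ j, beta k j = 0) → d k = 0 ∧ ∀ j, alpha k j = 0) ∧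
        (∀ k, ¬(∀ j, beta k j = 0) →
          d k = Real.sqrt (lam * ∑ j, |beta k j|) ∧
          ∀ j, alpha k j = beta k j / Real.sqrt (lam * ∑ j', |beta k j'|)) ∧
        (∑ k, d k) + lam * ∑ k, ∑ j, |alpha k j| =
          2 * Real.sqrt lam * ∑ k, Real.sqrt (∑ j, |beta k j|)) := by
  constructor
  · intro d alpha hd h
    rw [Finset.mul_sum, Finset.mul_sum, ← Finset.sum_add_distrib]
    refine Finset.sum_le_sum fun k _ => ?_
    have hS : ∑ j, |beta k j| = d k * ∑ j, |alpha k j| := by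
      rw [Finset.mul_sum]
      refine Finset.sum_congr rfl fun j _ => ?_
      rw [← h k j, abs_mul, abs_of_nonneg (hd k)]
    have hA : 0 ≤ ∑ j, |alpha k j| := Finset.sum_nonneg fun j _ => abs_nonneg _
    rw [hS, Real.sqrt_mul (hd k)]
    have h1 := Real.sq_sqrt (hd k)
    have h2 := Real.sq_sqrt hA
    have h3 := Real.sq_sqrt hlam.le
    have h4 := sq_nonneg (√(d k) - √lam * √(∑ j, |alpha k j|))
    have h5 : (√(d k) - √lam * √(∑ j, |alpha k j|)) ^ 2
        = √(d k) ^ 2 + √lam ^ 2 * √(∑ j, |alpha k j|) ^ 2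
          - 2 * √lam * (√(d k) * √(∑ j, |alpha k j|)) := by ring
    rw [h5, h1, h2, h3] at h4
    linarith
  · have hS : ∀ k, 0 ≤ ∑ j, |beta k j| := fun k => Finset.sum_nonneg fun j _ => abs_nonneg _
    refine ⟨fun k => √(lam * ∑ j, |beta k j|),
      fun k j => beta k j / √(lam * ∑ j', |beta k j'|), fun k => Real.sqrt_nonneg _,
      ?_, ?_, fun k _ => ⟨rfl, fun j => rfl⟩, ?_⟩
    · intro k j
      by_cases hb : beta k j = 0
      · simp [hb]
      · have h1 : |beta k j| ≤ ∑ j, |beta k j| :=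
          Finset.single_le_sum (f := fun j => |beta k j|) (fun j _ => abs_nonneg _)
            (Finset.mem_univ j)
        have h2 : 0 < ∑ j, |beta k j| := lt_of_lt_of_le (abs_pos.mpr hb) h1
        exact mul_div_cancel₀ _ (Real.sqrt_pos.mpr (mul_pos hlam h2)).ne'
    · intro k hk
      simp [hk]
    · rw [Finset.mul_sum, Finset.mul_sum, ← Finset.sum_add_distrib]
      refine Finset.sum_congr rfl fun k _ => ?_
      have h1 : ∑ j, |beta k j / √(lam * ∑ j', |beta k j'|)|
          = (∑ j, |beta k j|) / √(lam * ∑ j', |beta k j'|) := by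
        rw [Finset.sum_div]
        refine Finset.sum_congr rfl fun j _ => ?_
        rw [abs_div, abs_of_nonneg (Real.sqrt_nonneg _)]
      simp only [h1]
      rw [← mul_div_assoc, Real.div_sqrt, Real.sqrt_mul hlam.le]
      ring
end

section
/- Let y ∈ ℝⁿ and let the vectors x_{kj} ∈ ℝⁿ (k = 1,…,K, j = 1,…,p_k) be orthonormal: ⟨x_{kj}, x_{kj}⟩ = 1 and ⟨x_{kj}, x_{k′j′}⟩ = 0 whenever (k,j) ≠ (k′,j′). Let b_{kj} = ⟨x_{kj}, y⟩, fix λ > 0 and d_k ≥ 0 for each k. Then the function α ↦ −(1/2) ‖y − Σ_{k=1}^K d_k Σ_{j=1}^{p_k} α_{kj} x_{kj}‖² − λ Σ_{k,j} |α_{kj}| has a maximizer α̂ given componentwise by α̂_{kj} = 𝟙(d_k > 0) · sgn(b_{kj}) · ( |b_{kj}|/d_k − λ/d_k² )₊, where (t)₊ = max(t, 0); moreover this maximizer is unique among α with α_{kj} = 0 whenever d_k = 0. -/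
open Finset Real

lemma scalar_aux (lam d b a h : ℝ) (hlam : 0 < lam) (hd : 0 ≤ d)
    (hh : h = if 0 < d then Real.sign b * max (|b| / d - lam / d ^ 2) 0 else 0) :
    (d * a * b - (d * a) ^ 2 / 2 - lam * |a|) + d ^ 2 / 2 * (a - h) ^ 2
      ≤ d * h * b - (d * h) ^ 2 / 2 - lam * |h| := by
  rcases hd.eq_or_lt with h0 | hpos
  · subst h0
    simp at hh
    subst hh
    have := abs_nonneg a
    simp
    positivity
  · rw [if_pos hpos] at hh
    have e : |b| / d - lam / d ^ 2 = (d * |b| - lam) / d ^ 2 := by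
      field_simp
    rw [e] at hh
    rcases le_or_gt (d * |b|) lam with hle | hgt
    · have : (d * |b| - lam) / d ^ 2 ≤ 0 :=
        div_nonpos_of_nonpos_of_nonneg (by linarith) (by positivity)
      rw [max_eq_right this, mul_zero] at hh
      subst hh
      have h1 : d * a * b ≤ d * |b| * |a| := by
        have := le_abs_self (a * b)
        rw [abs_mul] at this
        nlinarith
      have h2 : d * |b| * |a| ≤ lam * |a| := mul_le_mul_of_nonneg_right hle (abs_nonneg a)
      simp only [abs_zero]
      nlinarith
    · have hp : 0 < (d * |b| - lam) / d ^ 2 := div_pos (by linarith) (by positivity)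
      rw [max_eq_left hp.le] at hh
      have ht : d ^ 2 * ((d * |b| - lam) / d ^ 2) = d * |b| - lam := by field_simp
      set t := (d * |b| - lam) / d ^ 2 with htd
      clear_value t
      rcases lt_trichotomy b 0 with hb | hb | hb
      · rw [Real.sign_of_neg hb] at hh
        rw [abs_of_neg hb] at ht
        have h1 : |h| = t := by rw [hh]; simp [abs_of_pos hp]
        rw [h1, hh]
        have := mul_le_mul_of_nonneg_left (neg_abs_le a) hlam.le
        have e2 : d * b = -(d ^ 2 * t) - lam := by linarith
        have e3 : d * a * b = a * (-(d ^ 2 * t) - lam) := by rw [← e2]; ring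
        have e4 : d * (-1 * t) * b = -t * (-(d ^ 2 * t) - lam) := by rw [← e2]; ring
        rw [e3, e4]
        nlinarith
      · subst hb
        simp at hgt
        linarith
      · rw [Real.sign_of_pos hb, one_mul] at hh
        rw [abs_of_pos hb] at ht
        rw [hh, abs_of_pos hp]
        have := mul_le_mul_of_nonneg_left (le_abs_self a) hlam.le
        have e2 : d * b = d ^ 2 * t + lam := by linarith
        have e3 : d * a * b = a * (d ^ 2 * t + lam) := by rw [← e2]; ring
        have e4 : d * t * b = t * (d ^ 2 * t + lam) := by rw [← e2]; ring
        rw [e3, e4]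
        nlinarith

lemma expand_aux {ι : Type*} [Fintype ι] [DecidableEq ι] (n : ℕ) (y : Fin n → ℝ)
    (X : ι → Fin n → ℝ) (hX : ∀ s t, ∑ i, X s i * X t i = if s = t then 1 else 0)
    (c : ι → ℝ) :
    ∑ i, (y i - ∑ s, c s * X s i) ^ 2 =
      ∑ i, y i ^ 2 - 2 * ∑ s, c s * (∑ i, X s i * y i) + ∑ s, c s ^ 2 := by
  have h1 : ∑ s, c s * (∑ i, X s i * y i) = ∑ i, y i * ∑ s, c s * X s i := by
    simp only [Finset.mul_sum]
    rw [Finset.sum_comm]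
    exact Finset.sum_congr rfl fun i _ => Finset.sum_congr rfl fun s _ => by ring
  have h2 : ∑ i, (∑ s, c s * X s i) ^ 2 = ∑ s, c s ^ 2 := by
    have : ∀ i, (∑ s, c s * X s i) ^ 2 = ∑ s, ∑ t, c s * c t * (X s i * X t i) := by
      intro i
      rw [sq, Finset.sum_mul_sum]
      exact Finset.sum_congr rfl fun s _ => Finset.sum_congr rfl fun t _ => by ring
    simp only [this]
    rw [Finset.sum_comm]
    refine Finset.sum_congr rfl fun s _ => ?_
    rw [Finset.sum_comm]
    simp only [← Finset.mul_sum, hX]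
    simp [sq]
  rw [h1, ← h2, Finset.mul_sum, ← Finset.sum_sub_distrib, ← Finset.sum_add_distrib]
  exact Finset.sum_congr rfl fun i _ => by ring

/-- Soft-thresholding closed form for the α-update (Step 3) of the hierarchical
lasso algorithm under an orthonormal design: with `b_{kj} = ⟨x_{kj}, y⟩`, the
function `α ↦ -(1/2)‖y - Σₖ dₖ Σⱼ αₖⱼ x_{kj}‖² - λ Σₖⱼ |αₖⱼ|` has maximizer
`α̂_{kj} = 𝟙(dₖ > 0) · sgn(b_{kj}) · (|b_{kj}|/dₖ - λ/dₖ²)₊`, unique among `α`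
vanishing on groups with `dₖ = 0`. -/
theorem alpha_update_soft_threshold (n K : ℕ) (p : Fin K → ℕ)
    (y : Fin n → ℝ) (x : (k : Fin K) → Fin (p k) → Fin n → ℝ)
    (horth1 : ∀ k j, ∑ i, x k j i * x k j i = 1)
    (horth2 : ∀ (k k' : Fin K) (j : Fin (p k)) (j' : Fin (p k')),
      (⟨k, j⟩ : Σ k, Fin (p k)) ≠ ⟨k', j'⟩ → ∑ i, x k j i * x k' j' i = 0)
    (lam : ℝ) (hlam : 0 < lam)
    (d : Fin K → ℝ) (hd : ∀ k, 0 ≤ d k)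
    (b : (k : Fin K) → Fin (p k) → ℝ)
    (hb : ∀ k j, b k j = ∑ i, x k j i * y i)
    (F : ((k : Fin K) → Fin (p k) → ℝ) → ℝ)
    (hF : ∀ a, F a =
      -(1 / 2) * ∑ i, (y i - ∑ k, d k * ∑ j, a k j * x k j i) ^ 2
        - lam * ∑ k, ∑ j, |a k j|)
    (ahat : (k : Fin K) → Fin (p k) → ℝ)
    (hahat : ∀ k j, ahat k j =
      if 0 < d k then
        Real.sign (b k j) * max (|b k j| / d k - lam / (d k) ^ 2) 0
      else 0) :
    (∀ a, F a ≤ F ahat) ∧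
    (∀ a, (∀ k j, d k = 0 → a k j = 0) → F a = F ahat → a = ahat) := by
  classical
  have hX : ∀ s t : (Σ k, Fin (p k)), ∑ i, x s.1 s.2 i * x t.1 t.2 i = if s = t then 1 else 0 := by
    intro s t
    split_ifs with h
    · subst h
      exact horth1 _ _
    · exact horth2 _ _ _ _ h
  have key : ∀ a, F a = -(1 / 2) * ∑ i, y i ^ 2 + ∑ k, ∑ j,
      (d k * a k j * b k j - (d k * a k j) ^ 2 / 2 - lam * |a k j|) := by
    intro a
    have h := expand_aux n y (fun s : (Σ k, Fin (p k)) => x s.1 s.2) hX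
      (fun s => d s.1 * a s.1 s.2)
    simp only [← hb, Fintype.sum_sigma] at h
    rw [hF]
    simp only [Finset.mul_sum, ← mul_assoc] at h ⊢
    rw [← Finset.mul_sum, h]
    simp only [Finset.sum_sub_distrib, ← Finset.sum_div, ← Finset.mul_sum, mul_assoc]
    ring
  have hs : ∀ (a : (k : Fin K) → Fin (p k) → ℝ) k j, (d k * a k j * b k j - (d k * a k j) ^ 2 / 2 - lam * |a k j|)
      + d k ^ 2 / 2 * (a k j - ahat k j) ^ 2
      ≤ d k * ahat k j * b k j - (d k * ahat k j) ^ 2 / 2 - lam * |ahat k j| :=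
    fun a k j => scalar_aux lam (d k) (b k j) (a k j) (ahat k j) hlam (hd k) (hahat k j)
  have main : ∀ a, F a + ∑ k, ∑ j, d k ^ 2 / 2 * (a k j - ahat k j) ^ 2 ≤ F ahat := by
    intro a
    rw [key a, key ahat, add_assoc, ← Finset.sum_add_distrib]
    simp only [← Finset.sum_add_distrib]
    gcongr with k _ j _
    exact hs a k j
  have hn : ∀ (a : (k : Fin K) → Fin (p k) → ℝ) k j,
    0 ≤ d k ^ 2 / 2 * (a k j - ahat k j) ^ 2 := fun a k j => by positivity
  refine ⟨fun a => ?_, fun a ha hEq => ?_⟩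
  · have := main a
    have := Finset.sum_nonneg fun k (_ : k ∈ Finset.univ) =>
      Finset.sum_nonneg fun j (_ : j ∈ Finset.univ) => hn a k j
    linarith
  · have h1 := main a
    have hn2 : ∀ k ∈ Finset.univ, 0 ≤ ∑ j, d k ^ 2 / 2 * (a k j - ahat k j) ^ 2 :=
      fun k _ => Finset.sum_nonneg fun j _ => hn a k j
    have h0 := le_antisymm (by linarith) (Finset.sum_nonneg hn2)
    funext k j
    rcases (hd k).eq_or_lt with hk | hk
    · rw [ha k j hk.symm, hahat, if_neg (by linarith)]
    · have h2 := (Finset.sum_eq_zero_iff_of_nonneg hn2).1 h0 k (Finset.mem_univ _)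
      have h3 := (Finset.sum_eq_zero_iff_of_nonneg fun j _ => hn a k j).1 h2 j (Finset.mem_univ _)
      have h4 : d k ^ 2 / 2 ≠ 0 := by positivity
      have h5 := (mul_eq_zero.1 h3).resolve_left h4
      exact sub_eq_zero.1 (pow_eq_zero_iff two_ne_zero |>.1 h5)
end

section
/- Let y ∈ ℝⁿ and let the vectors x_{kj} ∈ ℝⁿ (k = 1,…,K, j = 1,…,p_k) be orthonormal: ⟨x_{kj}, x_{kj}⟩ = 1 and ⟨x_{kj}, x_{k′j′}⟩ = 0 whenever (k,j) ≠ (k′,j′). Let b_{kj} = ⟨x_{kj}, y⟩, fix α ∈ ℝ^{p_1}×…×ℝ^{p_K}, and set x̃_k = Σ_{j=1}^{p_k} α_{kj} x_{kj}. Then the function d ↦ −(1/2) ‖y − Σ_{k=1}^K d_k x̃_k‖² − Σ_{k=1}^K d_k over {d ∈ ℝ^K : d_k ≥ 0 for all k} has a maximizer d̂ given componentwise by: d̂_k = 0 if α_{kj} = 0 for all j, and d̂_k = ( Σ_{j=1}^{p_k} α_{kj} b_{kj} − 1 )₊ / ( Σ_{j=1}^{p_k} α_{kj}² ) otherwise;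 this formula coincides with the shrunken weighted average d̂_k = ( Σ_j (α_{kj}²/Σ_j α_{kj}²)(b_{kj}/α_{kj}) − 1/Σ_j α_{kj}² )₊ when all α_{kj} ≠ 0, and the maximizer is unique among d with d_k = 0 whenever α_k = 0. -/
open Finset Real

/-- Nonnegative-garrote closed form for the d-update (Step 4) of the hierarchical
lasso algorithm under an orthonormal design: with `b_{kj} = ⟨x_{kj}, y⟩` and
`x̃ₖ = Σⱼ αₖⱼ x_{kj}`, the function `d ↦ -(1/2)‖y - Σₖ dₖ x̃ₖ‖² - Σₖ dₖ` over
`{d : dₖ ≥ 0}` has maximizer `d̂ₖ = 0` if `αₖ = 0` and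
`d̂ₖ = (Σⱼ αₖⱼ b_{kj} - 1)₊ / Σⱼ αₖⱼ²` otherwise; this coincides with the
shrunken weighted average formula when all `αₖⱼ ≠ 0`, and the maximizer is
unique among `d` vanishing on groups with `αₖ = 0`. -/
theorem d_update_garrote (n K : ℕ) (p : Fin K → ℕ)
    (y : Fin n → ℝ) (x : (k : Fin K) → Fin (p k) → Fin n → ℝ)
    (horth1 : ∀ k j, ∑ i, x k j i * x k j i = 1)
    (horth2 : ∀ (k k' : Fin K) (j : Fin (p k)) (j' : Fin (p k')),
      (⟨k, j⟩ : Σ k, Fin (p k)) ≠ ⟨k', j'⟩ → ∑ i, x k j i * x k' j' i = 0)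
    (alpha : (k : Fin K) → Fin (p k) → ℝ)
    (b : (k : Fin K) → Fin (p k) → ℝ)
    (hb : ∀ k j, b k j = ∑ i, x k j i * y i)
    (G : (Fin K → ℝ) → ℝ)
    (hG : ∀ d, G d =
      -(1 / 2) * ∑ i, (y i - ∑ k, d k * ∑ j, alpha k j * x k j i) ^ 2
        - ∑ k, d k)
    (dhat : Fin K → ℝ)
    (hdhat0 : ∀ k, (∀ j, alpha k j = 0) → dhat k = 0)
    (hdhat1 : ∀ k, ¬(∀ j, alpha k j = 0) →
      dhat k = max ((∑ j, alpha k j * b k j) - 1) 0 / ∑ j, (alpha k j) ^ 2) :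
    (∀ k, 0 ≤ dhat k) ∧
    (∀ d, (∀ k, 0 ≤ d k) → G d ≤ G dhat) ∧
    (∀ k, (∀ j, alpha k j ≠ 0) →
      dhat k = max (∑ j, ((alpha k j) ^ 2 / ∑ j', (alpha k j') ^ 2) *
          (b k j / alpha k j) - 1 / ∑ j', (alpha k j') ^ 2) 0) ∧
    (∀ d, (∀ k, 0 ≤ d k) → (∀ k, (∀ j, alpha k j = 0) → d k = 0) →
      G d = G dhat → d = dhat) := by
  have hxt : ∀ k k', ∑ i, (∑ j, alpha k j * x k j i) * (∑ j, alpha k' j * x k' j i)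
      = if k = k' then ∑ j, (alpha k j) ^ 2 else 0 := by
    intro k k'
    have h1 : ∑ i, (∑ j, alpha k j * x k j i) * (∑ j, alpha k' j * x k' j i)
        = ∑ j, ∑ j', alpha k j * alpha k' j' * ∑ i, x k j i * x k' j' i := by
      simp_rw [Finset.sum_mul_sum, Finset.mul_sum]
      rw [Finset.sum_comm]
      refine Finset.sum_congr rfl fun j _ => ?_
      rw [Finset.sum_comm]
      refine Finset.sum_congr rfl fun j' _ => Finset.sum_congr rfl fun i _ => ?_
      ring
    rw [h1]
    split_ifs with h
    · subst h
      refine Finset.sum_congr rfl fun j _ => ?_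
      rw [Finset.sum_eq_single j]
      · rw [horth1]; ring
      · intro j' _ hne
        rw [horth2 k k j j' (by
          intro h
          apply hne
          simpa using h.symm)]
        ring
      · simp
    · refine Finset.sum_eq_zero fun j _ => Finset.sum_eq_zero fun j' _ => ?_
      rw [horth2 k k' j j' (by
        intro h'
        exact h (congrArg Sigma.fst h'))]
      ring
  have hxy : ∀ k, ∑ i, y i * (∑ j, alpha k j * x k j i) = ∑ j, alpha k j * b k j := by
    intro k
    simp_rw [hb, Finset.mul_sum]
    rw [Finset.sum_comm]
    refine Finset.sum_congr rfl fun j _ => Finset.sum_congr rfl fun i _ => ?_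
    ring
  have hG' : ∀ d, G d = -(1 / 2) * ∑ i, y i ^ 2 + ∑ k, (d k * (∑ j, alpha k j * b k j)
      - 1 / 2 * (d k ^ 2 * ∑ j, (alpha k j) ^ 2) - d k) := by
    intro d
    rw [hG]
    have e1 : ∑ i, y i * (∑ k, d k * ∑ j, alpha k j * x k j i)
        = ∑ k, d k * (∑ j, alpha k j * b k j) := by
      simp_rw [← hxy]
      simp_rw [Finset.mul_sum (s := (Finset.univ : Finset (Fin K)))]
      rw [Finset.sum_comm]
      refine Finset.sum_congr rfl fun k _ => ?_
      rw [Finset.mul_sum]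
      refine Finset.sum_congr rfl fun i _ => ?_
      ring
    have e2 : ∑ i, (∑ k, d k * ∑ j, alpha k j * x k j i) ^ 2
        = ∑ k, d k ^ 2 * ∑ j, (alpha k j) ^ 2 := by
      have h1 : ∑ i, (∑ k, d k * ∑ j, alpha k j * x k j i) ^ 2
          = ∑ k, ∑ k', d k * d k' *
            ∑ i, (∑ j, alpha k j * x k j i) * (∑ j, alpha k' j * x k' j i) := by
        simp_rw [pow_two, Finset.sum_mul_sum (s := (Finset.univ : Finset (Fin K)))]
        rw [Finset.sum_comm]
        refine Finset.sum_congr rfl fun k _ => ?_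
        rw [Finset.sum_comm]
        refine Finset.sum_congr rfl fun k' _ => ?_
        rw [Finset.mul_sum]
        refine Finset.sum_congr rfl fun i _ => ?_
        ring
      rw [h1]
      simp_rw [hxt]
      simp [pow_two]
    have e3 : ∑ i, (y i - ∑ k, d k * ∑ j, alpha k j * x k j i) ^ 2
        = ∑ i, y i ^ 2 - 2 * ∑ i, y i * (∑ k, d k * ∑ j, alpha k j * x k j i)
          + ∑ i, (∑ k, d k * ∑ j, alpha k j * x k j i) ^ 2 := by
      rw [Finset.mul_sum, ← Finset.sum_sub_distrib, ← Finset.sum_add_distrib]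
      refine Finset.sum_congr rfl fun i _ => ?_
      ring
    rw [e3, e1, e2, Finset.sum_sub_distrib, Finset.sum_sub_distrib,
      ← Finset.mul_sum (s := (Finset.univ : Finset (Fin K)))]
    ring
  have hs : ∀ k, ¬(∀ j, alpha k j = 0) → 0 < ∑ j, (alpha k j) ^ 2 := by
    intro k h
    push Not at h
    obtain ⟨j, hj⟩ := h
    exact Finset.sum_pos' (fun j _ => sq_nonneg _) ⟨j, Finset.mem_univ _, by positivity⟩
  have hnn : ∀ k, 0 ≤ dhat k := by
    intro k
    by_cases h : ∀ j, alpha k j = 0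
    · rw [hdhat0 k h]
    · rw [hdhat1 k h]
      exact div_nonneg (le_max_right _ _) (hs k h).le
  have key : ∀ d : Fin K → ℝ, (∀ k, 0 ≤ d k) → ∀ k,
      (d k * (∑ j, alpha k j * b k j) - 1 / 2 * (d k ^ 2 * ∑ j, (alpha k j) ^ 2) - d k)
        + 1 / 2 * (∑ j, (alpha k j) ^ 2) * (d k - dhat k) ^ 2 ≤
      (dhat k * (∑ j, alpha k j * b k j) - 1 / 2 * (dhat k ^ 2 * ∑ j, (alpha k j) ^ 2)
        - dhat k) := by
    intro d hd k
    by_cases h : ∀ j, alpha k j = 0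
    · rw [hdhat0 k h]
      simp [h, hd k]
    · have hp := hs k h
      have h1 := hdhat1 k h
      have h2 : dhat k * ∑ j, (alpha k j) ^ 2 = max ((∑ j, alpha k j * b k j) - 1) 0 := by
        rw [h1]; field_simp
      have hdk := hd k
      generalize (∑ j, (alpha k j) ^ 2) = s at *
      generalize (∑ j, alpha k j * b k j) = c at *
      generalize d k = u at *
      generalize dhat k = v at *
      rcases le_total (c - 1) 0 with hc | hc
      · rw [max_eq_right hc] at h1
        have hv : v = 0 := by rw [h1]; simp
        subst hv
        nlinarith [mul_nonneg hdk (neg_nonneg.mpr hc)]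
      · rw [max_eq_left hc] at h2
        have hc' : c = v * s + 1 := by linarith
        subst hc'
        apply le_of_eq
        ring
  have hsn : ∀ k, 0 ≤ ∑ j, (alpha k j) ^ 2 := fun k => Finset.sum_nonneg fun j _ => sq_nonneg _
  have key' : ∀ d : Fin K → ℝ, (∀ k, 0 ≤ d k) →
      G d + ∑ k, 1 / 2 * (∑ j, (alpha k j) ^ 2) * (d k - dhat k) ^ 2 ≤ G dhat := by
    intro d hd
    rw [hG' d, hG' dhat, add_assoc, ← Finset.sum_add_distrib]
    have := Finset.sum_le_sum fun k (_ : k ∈ Finset.univ) => key d hd k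
    linarith
  have hq : ∀ d : Fin K → ℝ, ∀ k, 0 ≤ 1 / 2 * (∑ j, (alpha k j) ^ 2) * (d k - dhat k) ^ 2 :=
    fun d k => mul_nonneg (mul_nonneg (by norm_num) (hsn k)) (sq_nonneg _)
  refine ⟨hnn, ?_, ?_, ?_⟩
  · intro d hd
    have h1 := key' d hd
    have h2 := Finset.sum_nonneg fun k (_ : k ∈ Finset.univ) => hq d k
    linarith
  · intro k hk
    have e : ∑ j, ((alpha k j) ^ 2 / ∑ j', (alpha k j') ^ 2) * (b k j / alpha k j)
        = (∑ j, alpha k j * b k j) / ∑ j', (alpha k j') ^ 2 := by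
      rw [Finset.sum_div]
      refine Finset.sum_congr rfl fun j _ => ?_
      have := hk j
      field_simp
    rw [e, ← sub_div]
    by_cases h : ∀ j, alpha k j = 0
    · rw [hdhat0 k h]
      simp [h]
    · rw [hdhat1 k h, ← max_div_div_right (hs k h).le, zero_div]
  · intro d hd hd0 he
    have h1 := key' d hd
    have h3 : ∑ k, 1 / 2 * (∑ j, (alpha k j) ^ 2) * (d k - dhat k) ^ 2 = 0 :=
      le_antisymm (by linarith) (Finset.sum_nonneg fun k _ => hq d k)
    rw [Finset.sum_eq_zero_iff_of_nonneg fun k _ => hq d k] at h3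
    funext k
    by_cases h : ∀ j, alpha k j = 0
    · rw [hdhat0 k h, hd0 k h]
    · have h4 := h3 k (Finset.mem_univ _)
      have hp := hs k h
      have h5 : (d k - dhat k) ^ 2 = 0 := by
        rcases mul_eq_zero.mp h4 with h6 | h6
        · linarith
        · exact h6
      exact sub_eq_zero.mp (pow_eq_zero_iff (two_ne_zero) |>.mp h5)
end

section
/- Let λ > 0 and 0 < a ≤ b. For all β ∈ ℝ^p with a ≤ ‖β‖₁ ≤ b and all Δ ∈ ℝ^p with ‖Δ‖₁ < a/2, one has ‖ (β + Δ)/√(λ‖β + Δ‖₁) − β/√(λ‖β‖₁) ‖₁ ≤ ‖Δ‖₁ · ( 1/√(λa/2) + b/(a√(λa)) ). -/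
open Finset Real

/-- Perturbation bound for the normalized vector `β/√(λ‖β‖₁)`: if
`0 < a ≤ ‖β‖₁ ≤ b` and `‖Δ‖₁ < a/2`, then
`‖(β+Δ)/√(λ‖β+Δ‖₁) - β/√(λ‖β‖₁)‖₁ ≤ ‖Δ‖₁ (1/√(λa/2) + b/(a√(λa)))`. -/
theorem normalized_vector_perturbation_bound (p : ℕ) (lam a b : ℝ)
    (hlam : 0 < lam) (ha : 0 < a) (hab : a ≤ b)
    (beta Delta : Fin p → ℝ)
    (hbeta1 : a ≤ ∑ j, |beta j|) (hbeta2 : ∑ j, |beta j| ≤ b)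
    (hDelta : ∑ j, |Delta j| < a / 2) :
    ∑ j, |(beta j + Delta j) / Real.sqrt (lam * ∑ j', |beta j' + Delta j'|) -
        beta j / Real.sqrt (lam * ∑ j', |beta j'|)| ≤
      (∑ j, |Delta j|) *
        (1 / Real.sqrt (lam * a / 2) + b / (a * Real.sqrt (lam * a))) := by
  have hMN : |(∑ j, |beta j + Delta j|) - (∑ j, |beta j|)| ≤ ∑ j, |Delta j| := by
    rw [← Finset.sum_sub_distrib]
    refine (Finset.abs_sum_le_sum_abs _ _).trans (Finset.sum_le_sum fun j _ => ?_)
    have := abs_abs_sub_abs_le_abs_sub (beta j + Delta j) (beta j)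
    simpa using this
  have hd0 : 0 ≤ ∑ j, |Delta j| := Finset.sum_nonneg fun j _ => abs_nonneg _
  have key : ∀ s t : ℝ, 0 < s → ∑ j, |(beta j + Delta j) / s - beta j / t| ≤
      (∑ j, |Delta j|) / s + (∑ j, |beta j|) * |1 / s - 1 / t| := by
    intro s t hs
    rw [Finset.sum_div, Finset.sum_mul, ← Finset.sum_add_distrib]
    refine Finset.sum_le_sum fun j _ => ?_
    have e : (beta j + Delta j) / s - beta j / t = Delta j / s + beta j * (1 / s - 1 / t) := by
      ring
    rw [e]
    refine (abs_add_le _ _).trans ?_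
    rw [abs_mul, abs_div, abs_of_pos hs]
  generalize hM : ∑ j, |beta j + Delta j| = M at *
  generalize hN : ∑ j, |beta j| = N at *
  generalize hd : ∑ j, |Delta j| = d at *
  have hMa : a / 2 < M := by
    have := (abs_le.mp hMN).1
    linarith
  have hM0 : 0 < M := by linarith
  have hN0 : 0 < N := by linarith
  have hs : 0 < √(lam * M) := Real.sqrt_pos.mpr (by positivity)
  have ht : 0 < √(lam * N) := Real.sqrt_pos.mpr (by positivity)
  have hu : 0 < √(lam * a) := Real.sqrt_pos.mpr (by positivity)
  have hs2 : √(lam * M) ^ 2 = lam * M := Real.sq_sqrt (by positivity)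
  have ht2 : √(lam * N) ^ 2 = lam * N := Real.sq_sqrt (by positivity)
  have hu2 : √(lam * a) ^ 2 = lam * a := Real.sq_sqrt (by positivity)
  have hut : √(lam * a) ≤ √(lam * N) := Real.sqrt_le_sqrt (by gcongr)
  have hws : √(lam * a / 2) ≤ √(lam * M) := Real.sqrt_le_sqrt (by nlinarith)
  have hw : 0 < √(lam * a / 2) := Real.sqrt_pos.mpr (by positivity)
  refine (key _ √(lam * N) hs).trans ?_
  rw [mul_add]
  have h1 : d / √(lam * M) ≤ d * (1 / √(lam * a / 2)) := by
    rw [mul_one_div]; gcongr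
  generalize √(lam * M) = s at *
  generalize √(lam * N) = t at *
  generalize √(lam * a) = u at *
  have hsu2 : u ^ 2 / 2 ≤ s ^ 2 := by rw [hs2, hu2]; nlinarith
  have hsu : u / 2 ≤ s := by nlinarith
  have hprod : u ^ 2 * u ≤ s * t * (s + t) := by
    have h3 : u ^ 2 ≤ s * (s + t) := by nlinarith
    calc u ^ 2 * u ≤ (s * (s + t)) * t := by gcongr
      _ = _ := by ring
  have e : 1 / s - 1 / t = lam * (N - M) / (s * t * (s + t)) := by
    have : lam * (N - M) = t ^ 2 - s ^ 2 := by rw [hs2, ht2]; ring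
    rw [this]; field_simp; ring
  have h2 : N * |1 / s - 1 / t| ≤ d * (b / (a * u)) := by
    rw [e, abs_div, abs_mul, abs_of_pos hlam, abs_of_pos (show 0 < s * t * (s + t) by positivity),
      abs_sub_comm]
    calc N * (lam * |M - N| / (s * t * (s + t))) ≤ b * (lam * d / (u ^ 2 * u)) := by
          have hb0 : 0 ≤ b := by linarith
          gcongr
      _ = d * (b / (a * u)) := by rw [hu2]; field_simp
  linarith
end

section
/- Let w_1,…,w_s ≥ 0 be weights and let β, u ∈ ℝ^s satisfy Σ_{j=1}^s w_j|u_j| < Σ_{j=1}^s w_j|β_j|. Then √( Σ_j w_j|β_j + u_j| ) ≥ √( Σ_j w_j|β_j| ) − ( Σ_j w_j|u_j| ) / ( 2 √( Σ_j w_j|β_j| − Σ_j w_j|u_j| ) ). -/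
open Finset Real

/-- Lower bound on the perturbed weighted square-root-L1 penalty: if
`Σⱼ wⱼ|uⱼ| < Σⱼ wⱼ|βⱼ|` with `wⱼ ≥ 0`, then
`√(Σⱼ wⱼ|βⱼ+uⱼ|) ≥ √(Σⱼ wⱼ|βⱼ|) - (Σⱼ wⱼ|uⱼ|)/(2√(Σⱼ wⱼ|βⱼ| - Σⱼ wⱼ|uⱼ|))`. -/
theorem weighted_sqrt_l1_lower_bound (s : ℕ) (w : Fin s → ℝ)
    (hw : ∀ j, 0 ≤ w j) (beta u : Fin s → ℝ)
    (h : ∑ j, w j * |u j| < ∑ j, w j * |beta j|) :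
    Real.sqrt (∑ j, w j * |beta j + u j|) ≥
      Real.sqrt (∑ j, w j * |beta j|) -
        (∑ j, w j * |u j|) /
          (2 * Real.sqrt ((∑ j, w j * |beta j|) - ∑ j, w j * |u j|)) := by
  have htri : (∑ j, w j * |beta j|) - ∑ j, w j * |u j| ≤ ∑ j, w j * |beta j + u j| := by
    rw [← Finset.sum_sub_distrib]
    refine Finset.sum_le_sum fun j _ => ?_
    rw [← mul_sub]
    refine mul_le_mul_of_nonneg_left ?_ (hw j)
    have h1 := abs_sub_abs_le_abs_sub (beta j) (-u j)
    rwa [abs_neg, sub_neg_eq_add] at h1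
  have hB : 0 ≤ ∑ j, w j * |u j| :=
    Finset.sum_nonneg fun j _ => mul_nonneg (hw j) (abs_nonneg _)
  refine le_trans ?_ (Real.sqrt_le_sqrt htri)
  generalize (∑ j, w j * |beta j|) = A at *
  generalize (∑ j, w j * |u j|) = B at *
  have hc : 0 < Real.sqrt (A - B) := Real.sqrt_pos.mpr (sub_pos.mpr h)
  have hc2 := Real.sq_sqrt (sub_pos.mpr h).le
  have ha2 := Real.sq_sqrt (hB.trans h.le)
  rw [sub_le_iff_le_add, ← sub_le_iff_le_add', le_div_iff₀ (by positivity)]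
  nlinarith [sq_nonneg (Real.sqrt A - Real.sqrt (A - B))]
end
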